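/- arXiv:1907.01064 — 3 statements merged into one kernel-verified Lean document; each statement's English description precedes it below -/
import Mathlib

section
/- For every σ > 0 and every s ≥ 0, the function x ↦ ( 1/(2σ²) ) · exp( −(s² + x)/(2σ²) ) · I₀( s √x / σ² ) is a probability density on (0, ∞), i.e. ∫₀^∞ ( 1/(2σ²) ) · exp( −(s² + x)/(2σ²) ) · I₀( s √x / σ² ) dx = 1. -/
open MeasureTheory

/-- The modified Bessel function of the first kind of order zero,
`I₀(x) = Σ_{k=0}^∞ (x^k / (2^k k!))²`. -/
noncomputable def besselI0 (x : ℝ) : ℝ :=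
  ∑' k : ℕ, (x ^ k / (2 ^ k * Nat.factorial k)) ^ 2

/-- The integral of `x ^ k * exp (-(r * x))` over the positive half-line, for natural `k`. -/
theorem integral_pow_mul_exp_neg_mul_Ioi (k : ℕ) {r : ℝ} (hr : 0 < r) :
    ∫ x in Set.Ioi (0 : ℝ), x ^ k * Real.exp (-(r * x)) = Nat.factorial k / r ^ (k + 1) := by
  have h := Real.integral_rpow_mul_exp_neg_mul_Ioi (a := (k : ℝ) + 1) (by positivity) hr
  rw [Real.Gamma_nat_eq_factorial] at h
  simp only [add_sub_cancel_right, Real.rpow_natCast] at h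
  rw [h, show (k : ℝ) + 1 = ((k + 1 : ℕ) : ℝ) by push_cast; rfl, Real.rpow_natCast, one_div,
    inv_pow]
  ring

theorem integrableOn_pow_mul_exp_neg_mul_Ioi (k : ℕ) {r : ℝ} (hr : 0 < r) :
    IntegrableOn (fun x : ℝ => x ^ k * Real.exp (-(r * x))) (Set.Ioi 0) := by
  refine not_imp_comm.1 integral_undef ?_
  rw [integral_pow_mul_exp_neg_mul_Ioi k hr]
  positivity

/-- Mixing Gamma densities of rate `r` with Poisson weights of parameter `l` yields a function
of total mass one. -/
theorem integral_tsum_poisson_gamma_eq_one {r l : ℝ} (hr : 0 < r) (hl : 0 ≤ l) :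
    ∫ x in Set.Ioi (0 : ℝ), ∑' k : ℕ, r * Real.exp (-l) * (l * r) ^ k / (Nat.factorial k : ℝ) ^ 2
      * (x ^ k * Real.exp (-(r * x))) = 1 := by
  have hint (k : ℕ) : ∫ x in Set.Ioi (0 : ℝ),
      r * Real.exp (-l) * (l * r) ^ k / (Nat.factorial k : ℝ) ^ 2
        * (x ^ k * Real.exp (-(r * x))) = Real.exp (-l) * (l ^ k / Nat.factorial k) := by
    rw [integral_const_mul, integral_pow_mul_exp_neg_mul_Ioi k hr]
    have := Nat.factorial_ne_zero k
    field_simp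
    ring
  have hexp : HasSum (fun k : ℕ => Real.exp (-l) * (l ^ k / Nat.factorial k)) 1 := by
    have h := (NormedSpace.expSeries_div_hasSum_exp l).mul_left (Real.exp (-l))
    rwa [← Real.exp_eq_exp_ℝ, ← Real.exp_add, neg_add_cancel, Real.exp_zero] at h
  have hsum := hasSum_integral_of_summable_integral_norm
    (μ := volume.restrict (Set.Ioi (0 : ℝ)))
    (fun k : ℕ => (integrableOn_pow_mul_exp_neg_mul_Ioi k hr).const_mul
      (r * Real.exp (-l) * (l * r) ^ k / (Nat.factorial k : ℝ) ^ 2)) (by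
      refine hexp.summable.congr fun k => ?_
      rw [← hint k]
      refine setIntegral_congr_fun measurableSet_Ioi fun x (hx : 0 < x) => ?_
      exact (Real.norm_of_nonneg (by positivity)).symm)
  simp only [hint] at hsum
  exact hsum.unique hexp

/-- The noncentral chi-square density with two degrees of freedom integrates
to one on `(0, ∞)`. -/
theorem noncentral_chisq_density_integral_eq_one
    (σ : ℝ) (hσ : 0 < σ) (s : ℝ) (hs : 0 ≤ s) :
    ∫ x in Set.Ioi (0 : ℝ),
        (1 / (2 * σ ^ 2)) * Real.exp (-(s ^ 2 + x) / (2 * σ ^ 2))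
          * besselI0 (s * Real.sqrt x / σ ^ 2) = 1 := by
  refine Eq.trans ?_ (integral_tsum_poisson_gamma_eq_one (r := 1 / (2 * σ ^ 2))
    (l := s ^ 2 / (2 * σ ^ 2)) (by positivity) (by positivity))
  refine setIntegral_congr_fun measurableSet_Ioi fun x (hx : 0 < x) => ?_
  simp only [besselI0]
  rw [← tsum_mul_left]
  refine tsum_congr fun k => ?_
  have hexp : Real.exp (-(s ^ 2 + x) / (2 * σ ^ 2)) =
      Real.exp (-(s ^ 2 / (2 * σ ^ 2))) * Real.exp (-(1 / (2 * σ ^ 2) * x)) := by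
    rw [← Real.exp_add]
    ring_nf
  have hpow : ((s * Real.sqrt x / σ ^ 2) ^ k / (2 ^ k * Nat.factorial k)) ^ 2 =
      (s ^ 2 / (2 * σ ^ 2) * (1 / (2 * σ ^ 2))) ^ k * x ^ k / (Nat.factorial k : ℝ) ^ 2 := by
    rw [← div_div, ← div_pow, div_pow, ← pow_mul, mul_comm k 2, pow_mul, ← mul_pow]
    congr 2
    rw [div_pow, div_pow, mul_pow, Real.sq_sqrt hx.le]
    field_simp
  rw [hexp, hpow]
  ring
end

section
/- Let X and Y be independent real Gaussian random variables with means μ₁ and μ₂ and common variance σ² > 0, and set s² = μ₁² + μ₂². Then the random variable X² + Y² has a density with respect to Lebesgue measure given by f(x) = ( 1/(2σ²) ) · exp( −(s² + x)/(2σ²) ) · I₀( s √x / σ² ) for x > 0 and f(x) = 0 for x ≤ 0; that is, the law of X² + Y² is the measure with this density (the noncentral chi-square distribution with two degrees of freedom). -/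
open MeasureTheory ProbabilityTheory

open scoped Real

/-- Termwise integration of the exponential series `exp (c * u θ)` against `g`. -/
theorem hasSum_integral_exp_unit_mul {a b : ℝ} {u g : ℝ → ℂ} (hu : Continuous u)
    (hu1 : ∀ θ, ‖u θ‖ = 1) (hg : Continuous g) {M : ℝ} (hM : ∀ θ, ‖g θ‖ ≤ M) (c : ℂ) :
    HasSum (fun k : ℕ => c ^ k / (k.factorial : ℂ) * ∫ θ in a..b, u θ ^ k * g θ)
      (∫ θ in a..b, Complex.exp (c * u θ) * g θ) := by
  simp_rw [← intervalIntegral.integral_const_mul]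
  refine intervalIntegral.hasSum_integral_of_dominated_convergence
    (fun k _ => ‖c‖ ^ k / k.factorial * M) (fun k => ?_) (fun k => ?_) ?_ ?_ ?_
  · exact Continuous.aestronglyMeasurable (by fun_prop)
  · refine .of_forall fun θ _ => ?_
    simp only [norm_mul, norm_div, norm_pow, hu1, one_pow, one_mul, Complex.norm_natCast]
    gcongr
    exact hM θ
  · exact .of_forall fun θ _ => (Real.summable_pow_div_factorial ‖c‖).mul_right M
  · exact intervalIntegrable_const
  · refine .of_forall fun θ _ => ?_
    have h := (NormedSpace.expSeries_div_hasSum_exp (c * u θ)).mul_right (g θ)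
    rw [← Complex.exp_eq_exp_ℂ] at h
    have hterm : (fun k : ℕ => c ^ k / (k.factorial : ℂ) * (u θ ^ k * g θ))
        = fun k : ℕ => (c * u θ) ^ k / (k.factorial : ℂ) * g θ := by
      ext k
      rw [mul_pow]
      ring
    rwa [hterm]

/-- Orthogonality of the characters of the circle. -/
theorem integral_exp_int_mul_I (n : ℤ) :
    ∫ θ in (-π)..π, Complex.exp (n * (θ * Complex.I)) = if n = 0 then 2 * (π : ℂ) else 0 := by
  split_ifs with hn
  · subst hn
    simp
    ring
  · have hc : (n : ℂ) * Complex.I ≠ 0 := by simp [hn]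
    have h := integral_exp_mul_complex (a := -π) (b := π) hc
    have hperiod : Complex.exp (n * Complex.I * (π : ℝ))
        = Complex.exp (n * Complex.I * ((-π : ℝ) : ℂ)) := by
      rw [Complex.exp_eq_exp_iff_exists_int]
      exact ⟨n, by push_cast; ring⟩
    rw [hperiod, sub_self, zero_div] at h
    rw [← h]
    congr 1 with θ
    ring_nf

theorem integral_exp_mul_exp_neg_mul_pow (c : ℂ) (m : ℕ) :
    ∫ θ in (-π)..π, Complex.exp (c * Complex.exp (-(θ * Complex.I))) *
      Complex.exp (θ * Complex.I) ^ m = 2 * π * (c ^ m / (m.factorial : ℂ)) := by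
  have h := hasSum_integral_exp_unit_mul (a := -π) (b := π)
    (u := fun θ : ℝ => Complex.exp (-(θ * Complex.I)))
    (g := fun θ : ℝ => Complex.exp (θ * Complex.I) ^ m) (by fun_prop)
    (fun θ => by simp [Complex.norm_exp]) (by fun_prop) (M := 1)
    (fun θ => by simp [Complex.norm_exp]) c
  have hint (k : ℕ) : ∫ θ in (-π)..π,
      Complex.exp (-(θ * Complex.I)) ^ k * Complex.exp (θ * Complex.I) ^ m
        = if k = m then 2 * (π : ℂ) else 0 := by
    have := integral_exp_int_mul_I ((m : ℤ) - k)
    simp only [sub_eq_zero, Nat.cast_inj, eq_comm (a := m)] at this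
    rw [← this]
    congr 1 with θ
    rw [← Complex.exp_nat_mul, ← Complex.exp_nat_mul, ← Complex.exp_add]
    push_cast
    ring_nf
  simp_rw [hint] at h
  rw [h.unique (hasSum_single m fun k hk => by simp [hk])]
  simp
  ring

/-- Parseval's identity for `θ ↦ exp (c * exp (I * θ))`. -/
theorem hasSum_integral_exp_mul_exp_conj (c : ℂ) :
    HasSum (fun k : ℕ => 2 * (π : ℂ) * ((c * (starRingEnd ℂ) c) ^ k / (k.factorial : ℂ) ^ 2))
      (∫ θ in (-π)..π, Complex.exp (c * Complex.exp (θ * Complex.I)) *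
        Complex.exp ((starRingEnd ℂ) c * Complex.exp (-(θ * Complex.I)))) := by
  have h := hasSum_integral_exp_unit_mul (a := -π) (b := π)
    (u := fun θ : ℝ => Complex.exp (θ * Complex.I))
    (g := fun θ : ℝ => Complex.exp ((starRingEnd ℂ) c * Complex.exp (-(θ * Complex.I))))
    (by fun_prop) (fun θ => by simp [Complex.norm_exp]) (by fun_prop) (M := Real.exp ‖c‖)
    (fun θ => by
      refine (Complex.norm_exp_le_exp_norm _).trans (Real.exp_le_exp.2 ?_)
      simp [Complex.norm_exp]) c
  convert h using 2 with k
  simp_rw [mul_comm (Complex.exp _ ^ k)]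
  rw [integral_exp_mul_exp_neg_mul_pow, mul_pow]
  ring

/-- The integral representation of `besselI0`, averaged over the circle. -/
theorem integral_exp_cos_add_sin (a b : ℝ) :
    ∫ θ in (-π)..π, Real.exp (a * Real.cos θ + b * Real.sin θ)
      = 2 * π * besselI0 (√(a ^ 2 + b ^ 2)) := by
  set c : ℂ := (a - b * Complex.I) / 2 with hc
  have h := hasSum_integral_exp_mul_exp_conj c
  have hconj : (starRingEnd ℂ) c = (a + b * Complex.I) / 2 := by
    simp [hc, map_div₀, Complex.conj_ofNat]
  have hcc : c * (starRingEnd ℂ) c = (((a ^ 2 + b ^ 2) / 4 : ℝ) : ℂ) := by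
    rw [hconj, hc]
    push_cast
    linear_combination (-(b : ℂ) ^ 2 / 4) * Complex.I_sq
  have hexp (θ : ℝ) : Complex.exp (c * Complex.exp (θ * Complex.I)) *
        Complex.exp ((starRingEnd ℂ) c * Complex.exp (-(θ * Complex.I)))
      = ((Real.exp (a * Real.cos θ + b * Real.sin θ) : ℝ) : ℂ) := by
    rw [← Complex.exp_add, hconj, hc, ← neg_mul, Complex.exp_mul_I, Complex.exp_mul_I,
      Complex.cos_neg, Complex.sin_neg]
    push_cast
    congr 1
    linear_combination (-(b : ℂ) * Complex.sin θ) * Complex.I_sq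
  simp_rw [hexp, hcc] at h
  rw [intervalIntegral.integral_ofReal] at h
  have hreal : HasSum (fun k : ℕ => 2 * π * (((a ^ 2 + b ^ 2) / 4) ^ k / (k.factorial : ℝ) ^ 2))
      (∫ θ in (-π)..π, Real.exp (a * Real.cos θ + b * Real.sin θ)) := by
    exact_mod_cast h
  rw [← hreal.tsum_eq, tsum_mul_left, besselI0]
  congr 2 with k
  rw [div_pow, div_pow, mul_pow, pow_right_comm (√(a ^ 2 + b ^ 2)), Real.sq_sqrt (by positivity),
    pow_right_comm (2 : ℝ), div_div]
  norm_num

theorem lintegral_exp_cos_add_sin (a b : ℝ) :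
    ∫⁻ θ in Set.Ioo (-π) π, ENNReal.ofReal (Real.exp (a * Real.cos θ + b * Real.sin θ))
      = ENNReal.ofReal (2 * π * besselI0 (√(a ^ 2 + b ^ 2))) := by
  rw [← integral_exp_cos_add_sin, intervalIntegral.integral_of_le (by linarith [Real.pi_pos]),
    integral_Ioc_eq_integral_Ioo, ofReal_integral_eq_lintegral_ofReal]
  · refine (Continuous.integrableOn_Icc (by fun_prop)).mono_set Set.Ioo_subset_Icc_self
  · exact .of_forall fun θ => (Real.exp_pos _).le

/-- The product of two Gaussian densities with the same variance, in polar coordinates. -/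
theorem gaussianPDF_mul_gaussianPDF_polar (μ₁ μ₂ : ℝ) (v : NNReal) (hv : 0 < v) (r θ : ℝ) :
    gaussianPDF μ₁ v (r * Real.cos θ) * gaussianPDF μ₂ v (r * Real.sin θ) =
      ENNReal.ofReal (1 / (2 * π * v) * Real.exp (-(μ₁ ^ 2 + μ₂ ^ 2 + r ^ 2) / (2 * v))) *
      ENNReal.ofReal (Real.exp (r * μ₁ / v * Real.cos θ + r * μ₂ / v * Real.sin θ)) := by
  have hv' : (0 : ℝ) < v := hv
  rw [gaussianPDF, gaussianPDF, ← ENNReal.ofReal_mul (gaussianPDFReal_nonneg _ _ _),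
    ← ENNReal.ofReal_mul (by positivity)]
  congr 1
  rw [gaussianPDFReal, gaussianPDFReal, mul_mul_mul_comm, ← mul_inv,
    Real.mul_self_sqrt (by positivity), ← Real.exp_add, mul_assoc (1 / (2 * π * (v : ℝ))),
    ← Real.exp_add, one_div]
  congr 2
  field_simp
  linear_combination (-r ^ 2) * Real.sin_sq_add_cos_sq θ

/-- The change of variables `x = r ^ 2` on the positive half-line. -/
theorem lintegral_Ioi_sq (f : ℝ → ENNReal) :
    ∫⁻ x in Set.Ioi 0, f x = ∫⁻ r in Set.Ioi 0, ENNReal.ofReal (2 * r) * f (r ^ 2) := by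
  have himage : (fun r : ℝ => r ^ 2) '' Set.Ioi 0 = Set.Ioi 0 := by
    ext x
    constructor
    · rintro ⟨r, hr, rfl⟩
      exact pow_pos (Set.mem_Ioi.1 hr) 2
    · intro hx
      exact ⟨√x, Real.sqrt_pos.2 hx, Real.sq_sqrt (le_of_lt hx)⟩
  have h := lintegral_image_eq_lintegral_abs_deriv_mul (s := Set.Ioi (0 : ℝ))
    (f := fun r => r ^ 2) (f' := fun r => 2 * r) measurableSet_Ioi
    (fun r _ => by simpa using (hasDerivAt_pow 2 r).hasDerivWithinAt)
    ((pow_left_strictMonoOn₀ two_ne_zero).injOn.mono fun r hr => le_of_lt hr) f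
  rw [himage] at h
  rw [h]
  refine setLIntegral_congr_fun measurableSet_Ioi fun r hr => ?_
  rw [Set.mem_Ioi] at hr
  rw [abs_of_pos (by positivity)]

theorem lintegral_gaussianPDF_mul_comp_sum_sq (μ₁ μ₂ : ℝ) (v : NNReal) (hv : 0 < v)
    {g : ℝ → ENNReal} (hg : Measurable g) :
    ∫⁻ p : ℝ × ℝ, gaussianPDF μ₁ v p.1 * gaussianPDF μ₂ v p.2 * g (p.1 ^ 2 + p.2 ^ 2) =
      ∫⁻ x in Set.Ioi 0, ENNReal.ofReal
        ((1 / (2 * (v : ℝ))) * Real.exp (-(μ₁ ^ 2 + μ₂ ^ 2 + x) / (2 * (v : ℝ)))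
              * besselI0 (√(μ₁ ^ 2 + μ₂ ^ 2) * √x / (v : ℝ))) * g x := by
  have hv' : (0 : ℝ) < v := hv
  rw [← lintegral_comp_polarCoord_symm, polarCoord_target, Measure.volume_eq_prod,
    ← Measure.prod_restrict, lintegral_prod _ ?_,
    lintegral_Ioi_sq (fun x => ENNReal.ofReal _ * g x)]
  · refine setLIntegral_congr_fun measurableSet_Ioi fun r hr => ?_
    rw [Set.mem_Ioi] at hr
    have hrad (θ : ℝ) : (r * Real.cos θ) ^ 2 + (r * Real.sin θ) ^ 2 = r ^ 2 := by
      linear_combination r ^ 2 * Real.sin_sq_add_cos_sq θ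
    simp only [polarCoord_symm_apply, smul_eq_mul, hrad, gaussianPDF_mul_gaussianPDF_polar _ _ _ hv]
    have harg : √((r * μ₁ / v) ^ 2 + (r * μ₂ / v) ^ 2)
        = √(μ₁ ^ 2 + μ₂ ^ 2) * √(r ^ 2) / (v : ℝ) := by
      rw [Real.sqrt_sq hr.le, show (r * μ₁ / v) ^ 2 + (r * μ₂ / v) ^ 2
        = (μ₁ ^ 2 + μ₂ ^ 2) * (r / v) ^ 2 by ring, Real.sqrt_mul (by positivity),
        Real.sqrt_sq (by positivity)]
      ring
    rw [lintegral_const_mul _ (by fun_prop), lintegral_mul_const _ (by fun_prop),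
      lintegral_const_mul _ (by fun_prop), lintegral_exp_cos_add_sin, harg, ← mul_assoc,
      ← mul_assoc, ← ENNReal.ofReal_mul (by positivity), ← ENNReal.ofReal_mul (by positivity),
      ← mul_assoc (ENNReal.ofReal (2 * r)), ← ENNReal.ofReal_mul (by positivity)]
    congr 2
    field_simp
  · refine Measurable.aemeasurable ?_
    simp only [polarCoord_symm_apply, smul_eq_mul]
    fun_prop

/-- If `X` and `Y` are independent real Gaussians with means `μ₁, μ₂` and
common variance `v > 0`, then `X² + Y²` has the noncentral chi-square
(two degrees of freedom) density. -/
theorem noncentral_chisq_of_sum_sq_gaussian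
    {Ω : Type} [MeasureSpace Ω] [IsProbabilityMeasure (ℙ : Measure Ω)]
    (X Y : Ω → ℝ) (hXm : Measurable X) (hYm : Measurable Y)
    (hindep : IndepFun X Y ℙ)
    (μ₁ μ₂ : ℝ) (v : NNReal) (hv : 0 < v)
    (hX : Measure.map X ℙ = gaussianReal μ₁ v)
    (hY : Measure.map Y ℙ = gaussianReal μ₂ v)
    (s2 : ℝ) (hs2 : s2 = μ₁ ^ 2 + μ₂ ^ 2) :
    Measure.map (fun ω => X ω ^ 2 + Y ω ^ 2) ℙ =
      volume.withDensity (fun x : ℝ => ENNReal.ofReal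
        (if 0 < x then
            (1 / (2 * (v : ℝ))) * Real.exp (-(s2 + x) / (2 * (v : ℝ)))
              * besselI0 (Real.sqrt s2 * Real.sqrt x / (v : ℝ))
          else 0)) := by
  have hv0 : v ≠ 0 := hv.ne'
  subst hs2
  ext S hS
  have hsq : Measurable fun p : ℝ × ℝ => p.1 ^ 2 + p.2 ^ 2 := by fun_prop
  have hg : Measurable (S.indicator (1 : ℝ → ENNReal)) := measurable_one.indicator hS
  have hmap : Measure.map (fun ω => X ω ^ 2 + Y ω ^ 2) ℙ
      = Measure.map (fun p : ℝ × ℝ => p.1 ^ 2 + p.2 ^ 2)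
        ((gaussianReal μ₁ v).prod (gaussianReal μ₂ v)) := by
    rw [← hX, ← hY, ← hindep.map_prod_eq_prod_map_map hXm.aemeasurable hYm.aemeasurable,
      Measure.map_map hsq (hXm.prodMk hYm)]
    rfl
  rw [hmap, gaussianReal_of_var_ne_zero _ hv0, gaussianReal_of_var_ne_zero _ hv0,
    prod_withDensity (by fun_prop) (by fun_prop), ← Measure.volume_eq_prod,
    ← lintegral_indicator_one hS, lintegral_map hg hsq,
    lintegral_withDensity_eq_lintegral_mul _ (by fun_prop)
      (g := fun p : ℝ × ℝ => S.indicator 1 (p.1 ^ 2 + p.2 ^ 2)) (hg.comp hsq)]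
  refine (lintegral_gaussianPDF_mul_comp_sum_sq μ₁ μ₂ v hv hg).trans ?_
  rw [withDensity_apply _ hS, ← lintegral_indicator hS, ← lintegral_indicator measurableSet_Ioi]
  congr 1 with x
  by_cases hx : 0 < x <;> by_cases hxS : x ∈ S <;> simp [Set.indicator, hx, hxS]
end

section
/- Let d ≥ 0, u ≥ 0, v ≥ 0 and R be real numbers, and set ω = 2^{−R} (1 + d) − 1. Then the inequality log₂(1 + d) − log₂( 1 + u / (1 + v) ) ≤ R holds if and only if ω (1 + v) ≤ u; likewise, the strict inequality log₂(1 + d) − log₂( 1 + u / (1 + v) ) < R holds if and only if ω (1 + v) < u. -/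
/-- The secrecy-rate outage condition `log₂(1+d) − log₂(1 + u/(1+v)) ≤ R`
(resp. `< R`) is equivalent to `ω(1+v) ≤ u` (resp. `ω(1+v) < u`), where
`ω = 2^{−R}(1+d) − 1`. -/
theorem outage_condition_equivalence
    (d u v R : ℝ) (hd : 0 ≤ d) (hu : 0 ≤ u) (hv : 0 ≤ v)
    (ω : ℝ) (hω : ω = (2 : ℝ) ^ (-R) * (1 + d) - 1) :
    (Real.logb 2 (1 + d) - Real.logb 2 (1 + u / (1 + v)) ≤ R ↔ ω * (1 + v) ≤ u) ∧
    (Real.logb 2 (1 + d) - Real.logb 2 (1 + u / (1 + v)) < R ↔ ω * (1 + v) < u) := by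
  have hv' : 0 < 1 + v := by linarith
  have hx : 0 < (2 : ℝ) ^ (-R) * (1 + d) := by positivity
  have hy : 0 < 1 + u / (1 + v) := by positivity
  have hlog : Real.logb 2 ((2 : ℝ) ^ (-R) * (1 + d)) = -R + Real.logb 2 (1 + d) := by
    rw [Real.logb_mul (by positivity) (by positivity),
      Real.logb_rpow (by norm_num) (by norm_num)]
  subst hω
  constructor
  · rw [← le_div_iff₀ hv', sub_le_iff_le_add' (b := (1 : ℝ)), ← Real.logb_le_logb one_lt_two hx hy, hlog]
    constructor <;> intro h <;> linarith
  · rw [← lt_div_iff₀ hv', sub_lt_iff_lt_add' (b := (1 : ℝ)), ← Real.logb_lt_logb_iff one_lt_two hx hy, hlog]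
    constructor <;> intro h <;> linarith
end
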